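/- Let ∅ ≠ E ⊂ X be a closed and porous set, let α ∈ ℝ, and set w = δ_E^{-α}. Then w belongs to the Muckenhoupt class A_1 if and only if 0 ≤ α < codim_A(E). -/

import Mathlib

open MeasureTheory Metric Set
open scoped ENNReal NNReal

namespace ApDistance

noncomputable section

variable {X : Type*} [MetricSpace X] [MeasurableSpace X] [BorelSpace X]

/-- All balls of positive radius have positive and finite measure. -/
def BallsPosFinite (μ : Measure X) : Prop :=
  ∀ (x : X) (r : ℝ), 0 < r → 0 < μ (ball x r) ∧ μ (ball x r) < ∞

/-- The measure `μ` is doubling with constant `C`. -/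
def DoublingWith (μ : Measure X) (C : ℝ) : Prop :=
  ∀ (x : X) (r : ℝ), 0 < r → μ (ball x (2 * r)) ≤ ENNReal.ofReal C * μ (ball x r)

/-- The measure `μ` is doubling. -/
def Doubling (μ : Measure X) : Prop :=
  ∃ C : ℝ, 0 < C ∧ DoublingWith μ C

/-- The (quantitative) reverse doubling condition with exponent `η`. -/
def ReverseDoubling (μ : Measure X) (η : ℝ) : Prop :=
  ∃ C : ℝ, 0 < C ∧ ∀ (x y : X) (r R : ℝ), 0 < r → 0 < R → ball y r ⊆ ball x R →
    μ (ball y r) ≤ ENNReal.ofReal (C * (r / R) ^ η) * μ (ball x R)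

/-- Standing assumptions (S1)-(S2): `X` is unbounded, points have measure zero,
and all annuli are nonempty. -/
def StandingAssumptions (μ : Measure X) : Prop :=
  ¬ Bornology.IsBounded (univ : Set X) ∧ (∀ x : X, μ {x} = 0) ∧
    ∀ (x : X) (r R : ℝ), 0 < r → r < R → (ball x R \ ball x r).Nonempty

/-- Ahlfors `Q`-regularity of the metric measure space. -/
def AhlforsRegular (μ : Measure X) (Q : ℝ) : Prop :=
  ∃ C : ℝ, 1 ≤ C ∧ ∀ (x : X) (r : ℝ), 0 < r → ENNReal.ofReal r < EMetric.diam (univ : Set X) →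
    ENNReal.ofReal (C⁻¹ * r ^ Q) ≤ μ (ball x r) ∧ μ (ball x r) ≤ ENNReal.ofReal (C * r ^ Q)

/-- The set of admissible exponents in the definition of the (upper) Assouad dimension:
`E ∩ B(x,R)` can be covered by at most `C (R/r)^s` balls of radius `r`. -/
def assouadDimBddSet (E : Set X) : Set ℝ :=
  {s : ℝ | 0 ≤ s ∧ ∃ C : ℝ, 1 ≤ C ∧ ∀ x ∈ E, ∀ r R : ℝ, 0 < r → r < R →
    ENNReal.ofReal R < 2 * EMetric.diam (univ : Set X) →
    ∃ F : Finset X, (F.card : ℝ) ≤ C * (R / r) ^ s ∧ E ∩ ball x R ⊆ ⋃ y ∈ F, ball y r}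

/-- The (upper) Assouad dimension of a set `E`. -/
def assouadDim (E : Set X) : ℝ := sInf (assouadDimBddSet E)

/-- The set of admissible exponents in the definition of the lower Assouad codimension. -/
def assouadCodimBddSet (μ : Measure X) (E : Set X) : Set ℝ :=
  {ρ : ℝ | 0 ≤ ρ ∧ ∃ C : ℝ, 1 ≤ C ∧ ∀ x ∈ E, ∀ r R : ℝ, 0 < r → r < R →
    ENNReal.ofReal R < 2 * EMetric.diam (univ : Set X) →
    μ ({y : X | infDist y E < r} ∩ ball x R) ≤
      ENNReal.ofReal (C * (r / R) ^ ρ) * μ (ball x R)}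

/-- The lower Assouad codimension of a set `E` with respect to `μ`. -/
def assouadCodim (μ : Measure X) (E : Set X) : ℝ := sSup (assouadCodimBddSet μ E)

/-- Porosity of a set `E ⊆ X`. -/
def IsPorous (E : Set X) : Prop :=
  ∃ c : ℝ, 0 < c ∧ c < 1 ∧ ∀ x ∈ E, ∀ r : ℝ, 0 < r →
    ENNReal.ofReal r < 2 * EMetric.diam (univ : Set X) →
    ∃ y : X, ball y (c * r) ⊆ ball x r \ E

/-- A weight: measurable, a.e. positive and finite, locally integrable on balls. -/
def IsWeight (μ : Measure X) (w : X → ℝ≥0∞) : Prop :=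
  Measurable w ∧ (∀ᵐ x ∂μ, 0 < w x ∧ w x ≠ ∞) ∧
    ∀ (x : X) (r : ℝ), 0 < r → ∫⁻ y in ball x r, w y ∂μ ≠ ∞

/-- Membership in the Muckenhoupt class `A_p`, `1 < p < ∞`. -/
def MemAp (μ : Measure X) (w : X → ℝ≥0∞) (p : ℝ) : Prop :=
  IsWeight μ w ∧ ∃ A : ℝ, 0 < A ∧ ∀ (x : X) (r : ℝ), 0 < r →
    ((∫⁻ y in ball x r, w y ∂μ) / μ (ball x r)) *
      ((∫⁻ y in ball x r, w y ^ (-(1 / (p - 1))) ∂μ) / μ (ball x r)) ^ (p - 1) ≤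
      ENNReal.ofReal A

/-- Membership in the Muckenhoupt class `A_1`. -/
def MemA1 (μ : Measure X) (w : X → ℝ≥0∞) : Prop :=
  IsWeight μ w ∧ ∃ A : ℝ, 0 < A ∧ ∀ (x : X) (r : ℝ), 0 < r →
    ((∫⁻ y in ball x r, w y ∂μ) / μ (ball x r)) *
      essSup (fun y => (w y)⁻¹) (μ.restrict (ball x r)) ≤ ENNReal.ofReal A

/-- Membership in the Muckenhoupt class `A_∞`. -/
def MemAinfty (μ : Measure X) (w : X → ℝ≥0∞) : Prop :=
  IsWeight μ w ∧ ∃ C d : ℝ, 0 < C ∧ 0 < d ∧ ∀ (x : X) (r : ℝ), 0 < r →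
    ∀ F : Set X, MeasurableSet F → F ⊆ ball x r →
      ∫⁻ y in F, w y ∂μ ≤
        ENNReal.ofReal C * (μ F / μ (ball x r)) ^ d * ∫⁻ y in ball x r, w y ∂μ

/-- The weight `w = δ_E^{-α} = dist(·,E)^{-α}` (with values in `ℝ≥0∞`). -/
def distWeight (E : Set X) (α : ℝ) : X → ℝ≥0∞ :=
  fun x => ENNReal.ofReal (infDist x E) ^ (-α)

/-- The Aikawa condition with exponent `α` and constant `C`. -/
def AikawaCondition (μ : Measure X) (E : Set X) (α C : ℝ) : Prop :=
  ∀ x ∈ E, ∀ r : ℝ, 0 < r → ENNReal.ofReal r < 2 * EMetric.diam (univ : Set X) →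
    ∫⁻ y in ball x r, ENNReal.ofReal (infDist y E) ^ (-α) ∂μ ≤
      ENNReal.ofReal (C * r ^ (-α)) * μ (ball x r)

/-- The Riesz potential `I_s f`. -/
def rieszPotential (μ : Measure X) (s : ℝ) (f : X → ℝ≥0∞) (x : X) : ℝ≥0∞ :=
  ∫⁻ y, f y * ENNReal.ofReal (dist x y ^ s) / μ (ball x (dist x y)) ∂μ

/-- `Lip_0(X)`: Lipschitz functions vanishing outside some ball. -/
def MemLip0 (f : X → ℝ) : Prop :=
  (∃ K : ℝ≥0, LipschitzWith K f) ∧ ∃ (x : X) (r : ℝ), ∀ y : X, y ∉ ball x r → f y = 0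

/-- The `λ`-chain condition. -/
def ChainCondition (X : Type*) [MetricSpace X] (lam : ℝ) : Prop :=
  ∃ M : ℝ, 1 ≤ M ∧ ∀ (x : X) (r R : ℝ), 0 < r → r < R →
    ∃ (k : ℕ) (c : ℕ → X) (ρ : ℕ → ℝ),
      (∀ i ≤ k, 0 < ρ i) ∧
      ball (c 0) (lam * ρ 0) ⊆ (ball x R)ᶜ ∧
      ball (c k) (lam * ρ k) ⊆ ball x r ∧
      (∀ i ≤ k,
        M⁻¹ * Metric.diam (ball (c i) (lam * ρ i)) ≤ infDist x (ball (c i) (lam * ρ i)) ∧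
        infDist x (ball (c i) (lam * ρ i)) ≤ M * Metric.diam (ball (c i) (lam * ρ i))) ∧
      (∀ i < k, ∃ (z : X) (t : ℝ), 0 < t ∧
        ball z t ⊆ ball (c i) (ρ i) ∩ ball (c (i + 1)) (ρ (i + 1)) ∧
        ball (c i) (ρ i) ∪ ball (c (i + 1)) (ρ (i + 1)) ⊆ ball z (M * t)) ∧
      (∀ y : X, (({i : ℕ | i ≤ k ∧ y ∈ ball (c i) (lam * ρ i)}).ncard : ℝ) ≤ M)

/-- The inner integral appearing in fractional Hardy–Sobolev inequalities:
`y ↦ ∫_X |f(y)-f(z)|^t / (d(y,z)^{st} μ(B(y,d(y,z)))) dμ(z)`. -/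
def fracEnergyKernel (μ : Measure X) (s t : ℝ) (f : X → ℝ) (y : X) : ℝ≥0∞ :=
  ∫⁻ z, ENNReal.ofReal (|f y - f z| ^ t) /
    (ENNReal.ofReal (dist y z ^ (s * t)) * μ (ball y (dist y z))) ∂μ


set_option linter.unusedSectionVars false

lemma distWeight_ge {E : Set X} {α s : ℝ} (hα : 0 ≤ α) (hs : 0 < s) {x : X}
    (hx : infDist x E ≤ s) : ENNReal.ofReal (s ^ (-α)) ≤ distWeight E α x := by
  unfold distWeight
  rw [← ENNReal.ofReal_rpow_of_pos hs, ENNReal.rpow_neg, ENNReal.rpow_neg]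
  gcongr

lemma distWeight_le {E : Set X} {α s : ℝ} (hα : 0 ≤ α) (hs : 0 < s) {x : X}
    (hx : s ≤ infDist x E) : distWeight E α x ≤ ENNReal.ofReal (s ^ (-α)) := by
  unfold distWeight
  rw [← ENNReal.ofReal_rpow_of_pos hs, ENNReal.rpow_neg, ENNReal.rpow_neg]
  gcongr

lemma distWeight_inv {E : Set X} {α : ℝ} (x : X) :
    (distWeight E α x)⁻¹ = ENNReal.ofReal (infDist x E) ^ α := by
  unfold distWeight
  rw [ENNReal.rpow_neg, inv_inv]

lemma measurable_distWeight (E : Set X) (α : ℝ) : Measurable (distWeight E α) := by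
  unfold distWeight
  fun_prop

lemma le_essSup_of_subset {μ : Measure X} {S B : Set X} {f : X → ℝ≥0∞} {a : ℝ≥0∞}
    (hSB : S ⊆ B) (hS : μ S ≠ 0) (h : ∀ y ∈ S, a ≤ f y) : a ≤ essSup f (μ.restrict B) := by
  by_contra hlt
  rw [not_le] at hlt
  have h1 : ∀ᵐ y ∂(μ.restrict B), f y ≤ essSup f (μ.restrict B) := ENNReal.ae_le_essSup f
  apply hS
  rw [← Measure.restrict_eq_self μ hSB]
  refine measure_mono_null ?_ (ae_iff.1 h1)
  intro y hy
  exact not_le.2 (hlt.trans_le (h y hy))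

lemma doubling_pow {μ : Measure X} {C : ℝ} (hd : DoublingWith μ C) (k : ℕ) (x : X) (r : ℝ)
    (hr : 0 < r) : μ (ball x (2 ^ k * r)) ≤ ENNReal.ofReal C ^ k * μ (ball x r) := by
  induction k with
  | zero => simp
  | succ k ih =>
    have := hd x (2 ^ k * r) (by positivity)
    rw [show (2:ℝ) ^ (k+1) * r = 2 * (2 ^ k * r) by ring, pow_succ']
    calc _ ≤ _ := this
      _ ≤ ENNReal.ofReal C * (ENNReal.ofReal C ^ k * μ (ball x r)) := by gcongr
      _ = _ := by ring

/-- Porosity ball: points of the half ball are at distance `≥ c s / 2` from `E`. -/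
lemma porous_half {E : Set X} (hE : E.Nonempty) {c s : ℝ} {y z : X} (hz : z ∈ E)
    (hc : 0 < c) (hs : 0 < s)
    (h : ball y (c * s) ⊆ ball z s \ E) {u : X} (hu : u ∈ ball y (c / 2 * s)) :
    c / 2 * s ≤ infDist u E ∧ infDist u E < s ∧ u ∈ ball z s := by
  have hu' : u ∈ ball y (c * s) := by
    rw [mem_ball] at hu ⊢
    have : 0 < c * s := by positivity
    linarith
  have huz := (h hu').1
  refine ⟨?_, (infDist_le_dist_of_mem hz).trans_lt huz, huz⟩
  rw [le_infDist hE]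
  intro e he
  by_contra hlt
  rw [not_le] at hlt
  have : e ∈ ball y (c * s) := by
    rw [mem_ball] at hu ⊢
    have := dist_triangle e u y
    rw [dist_comm e u] at this
    linarith
  exact (h this).2 he

/-- Enlarged Aikawa-type condition. -/
def AikP (μ : Measure X) (E : Set X) (α C : ℝ) (D : ℝ≥0∞) : Prop :=
  ∀ x ∈ E, ∀ r : ℝ, 0 < r → ENNReal.ofReal r < D →
    ∫⁻ y in ball x (8 * r), distWeight E α y ∂μ ≤
      ENNReal.ofReal (C * r ^ (-α)) * μ (ball x r)

lemma step (μ : Measure X) (hballs : BallsPosFinite μ) {CD : ℝ} (hd : DoublingWith μ CD)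
    (E : Set X) (hE : E.Nonempty) {c : ℝ} (hc : 0 < c) (hc1 : c < 1) {D : ℝ≥0∞}
    (hpor : ∀ x ∈ E, ∀ r : ℝ, 0 < r → ENNReal.ofReal r < D →
      ∃ y : X, ball y (c * r) ⊆ ball x r \ E)
    {α C : ℝ} (hα : 0 ≤ α) (hC : 0 ≤ C) (hA : AikP μ E α C D) :
    ∃ K : ℝ, 0 < K ∧ ∀ x : X, ∀ T s : ℝ, 0 < T → 0 < s → ENNReal.ofReal s < D →
      ∫⁻ y in ({y | infDist y E < s} ∩ ball x T), distWeight E α y ∂μ ≤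
      ENNReal.ofReal K * ∫⁻ y in ({y | c / 2 * s ≤ infDist y E ∧ infDist y E < s} ∩
        ball x (T + 2 * s)), distWeight E α y ∂μ := by
  obtain ⟨k, hk⟩ : ∃ k : ℕ, 4 / c < 2 ^ k := pow_unbounded_of_one_lt _ (by norm_num)
  refine ⟨C * (max CD 0) ^ k + 1, by positivity, ?_⟩
  intro x T s hT hs hsD
  obtain ⟨u, hut, hudisj, hucov⟩ := Vitali.exists_disjoint_subfamily_covering_enlargement_closedBall
    (E ∩ ball x (T + s)) (fun z : X => z) (fun _ => s) s (fun _ _ => le_rfl) 5 (by norm_num)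
  have huE : ∀ z ∈ u, z ∈ E := fun z hz => (hut hz).1
  choose! p hp using fun z (hz : z ∈ E) => hpor z hz s hs hsD
  have hcs : 0 < c / 2 * s := by positivity
  have hph : ∀ z ∈ u, ∀ v ∈ ball (p z) (c / 2 * s), c / 2 * s ≤ infDist v E ∧ infDist v E < s ∧
      v ∈ ball z s := fun z hz v hv => porous_half hE (huE z hz) hc hs (hp z (huE z hz)) hv
  have hpd : u.PairwiseDisjoint (fun z => ball (p z) (c / 2 * s)) := by
    intro a ha b hb hab
    refine (hudisj ha hb hab).mono ?_ ?_
    · exact fun v hv => ball_subset_closedBall (hph a ha v hv).2.2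
    · exact fun v hv => ball_subset_closedBall (hph b hb v hv).2.2
  have hsub : ∀ z ∈ u, ball (p z) (c / 2 * s) ⊆
      {y | c / 2 * s ≤ infDist y E ∧ infDist y E < s} ∩ ball x (T + 2 * s) := by
    intro z hz v hv
    obtain ⟨h1, h2, h3⟩ := hph z hz v hv
    refine ⟨⟨h1, h2⟩, ?_⟩
    have h4 := (hut hz).2
    rw [mem_ball] at h3 h4 ⊢
    have := dist_triangle v z x
    linarith
  have hcount : u.Countable := by
    have := Measure.countable_meas_pos_of_disjoint_of_meas_iUnion_ne_top μ
      (As := fun z : u => ball (p z) (c / 2 * s)) (fun _ => measurableSet_ball)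
      (by
        intro a b hab
        exact hpd a.2 b.2 (fun h => hab (Subtype.ext h)))
      (by
        refine ne_top_of_le_ne_top (hballs x (T + 2 * s) (by positivity)).2.ne
          (measure_mono (iUnion_subset fun z => (hsub z z.2).trans inter_subset_right)))
    have h2 : {i : u | 0 < μ (ball (p i) (c / 2 * s))} = univ := by
      ext i
      simpa using (hballs (p i) _ hcs).1
    rw [h2] at this
    exact countable_coe_iff.1 (countable_univ_iff.1 this)
  have : Countable u := hcount.to_subtype
  have hmain : ∀ z ∈ u, ∫⁻ y in ball z (8 * s), distWeight E α y ∂μ ≤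
      ENNReal.ofReal (C * (max CD 0) ^ k + 1) *
        ∫⁻ y in ball (p z) (c / 2 * s), distWeight E α y ∂μ := by
    intro z hz
    have h1 : ball z s ⊆ ball (p z) (2 ^ k * (c / 2 * s)) := by
      intro v hv
      have hpz := (hph z hz (p z) (mem_ball_self hcs)).2.2
      rw [mem_ball] at hv hpz ⊢
      have h3 := dist_triangle v z (p z)
      rw [dist_comm z] at h3
      have h4 : 2 * s < 2 ^ k * (c / 2 * s) := by
        rw [div_lt_iff₀ hc] at hk
        nlinarith
      linarith
    have h2 : μ (ball z s) ≤ ENNReal.ofReal ((max CD 0) ^ k) * μ (ball (p z) (c / 2 * s)) := by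
      refine (measure_mono h1).trans ((doubling_pow hd k _ _ hcs).trans ?_)
      rw [ENNReal.ofReal_pow (le_max_right _ _)]
      gcongr
      exact le_max_left _ _
    have h3 : ENNReal.ofReal (s ^ (-α)) * μ (ball (p z) (c / 2 * s)) ≤
        ∫⁻ y in ball (p z) (c / 2 * s), distWeight E α y ∂μ := by
      rw [← setLIntegral_const]
      exact setLIntegral_mono (measurable_distWeight E α)
        fun v hv => distWeight_ge hα hs (hph z hz v hv).2.1.le
    calc _ ≤ _ := hA z (huE z hz) s hs hsD
      _ ≤ ENNReal.ofReal (C * s ^ (-α)) *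
          (ENNReal.ofReal ((max CD 0) ^ k) * μ (ball (p z) (c / 2 * s))) := by gcongr
      _ = ENNReal.ofReal (C * (max CD 0) ^ k) *
          (ENNReal.ofReal (s ^ (-α)) * μ (ball (p z) (c / 2 * s))) := by
        rw [ENNReal.ofReal_mul hC, ENNReal.ofReal_mul hC]; ring
      _ ≤ _ := by
        gcongr
        linarith
  have hcov : {y | infDist y E < s} ∩ ball x T ⊆ ⋃ z : u, ball (z : X) (8 * s) := by
    rintro v ⟨hv1, hv2⟩
    obtain ⟨e, he, hve⟩ := (infDist_lt_iff hE).1 hv1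
    have het : e ∈ E ∩ ball x (T + s) := by
      refine ⟨he, ?_⟩
      rw [mem_ball] at hv2 ⊢
      have := dist_triangle e v x
      rw [dist_comm e v] at this
      linarith
    obtain ⟨b, hb, hbs⟩ := hucov e het
    have : v ∈ closedBall b (5 * s) := hbs hve.le
    refine mem_iUnion.2 ⟨⟨b, hb⟩, ?_⟩
    rw [mem_closedBall] at this
    rw [mem_ball]
    show dist v b < 8 * s
    linarith
  calc _ ≤ ∫⁻ y in ⋃ z : u, ball (z : X) (8 * s), distWeight E α y ∂μ := lintegral_mono_set hcov
    _ ≤ ∑' z : u, ∫⁻ y in ball (z : X) (8 * s), distWeight E α y ∂μ := lintegral_iUnion_le _ _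
    _ ≤ ∑' z : u, ENNReal.ofReal (C * (max CD 0) ^ k + 1) *
        ∫⁻ y in ball (p z) (c / 2 * s), distWeight E α y ∂μ :=
      ENNReal.tsum_le_tsum fun z => hmain z z.2
    _ = ENNReal.ofReal (C * (max CD 0) ^ k + 1) *
        ∫⁻ y in ⋃ z ∈ u, ball (p z) (c / 2 * s), distWeight E α y ∂μ := by
      rw [ENNReal.tsum_mul_left, lintegral_biUnion hcount (fun _ _ => measurableSet_ball) hpd]
    _ ≤ _ := by
      gcongr
      exact iUnion₂_subset hsub

lemma step2 (μ : Measure X) (hballs : BallsPosFinite μ) {CD : ℝ} (hd : DoublingWith μ CD)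
    (E : Set X) (hE : E.Nonempty) {c : ℝ} (hc : 0 < c) (hc1 : c < 1) {D : ℝ≥0∞}
    (hpor : ∀ x ∈ E, ∀ r : ℝ, 0 < r → ENNReal.ofReal r < D →
      ∃ y : X, ball y (c * r) ⊆ ball x r \ E)
    {α C : ℝ} (hα : 0 ≤ α) (hC : 0 ≤ C) (hA : AikP μ E α C D) :
    ∃ q : ℝ, 0 < q ∧ q < 1 ∧ ∀ x : X, ∀ T s : ℝ, 0 < T → 0 < s → ENNReal.ofReal s < D →
      ∫⁻ y in ({y | infDist y E < c / 2 * s} ∩ ball x T), distWeight E α y ∂μ ≤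
      ENNReal.ofReal q * ∫⁻ y in ({y | infDist y E < s} ∩
        ball x (T + 2 * s)), distWeight E α y ∂μ := by
  obtain ⟨K, hK, h⟩ := step μ hballs hd E hE hc hc1 hpor hα hC hA
  refine ⟨K / (1 + K), by positivity, by rw [div_lt_one (by positivity)]; linarith, ?_⟩
  intro x T s hT hs hsD
  have h1 := h x T s hT hs hsD
  set Φ := ∫⁻ y in ({y | infDist y E < c / 2 * s} ∩ ball x T), distWeight E α y ∂μ with hΦ
  set L := ∫⁻ y in ({y | c / 2 * s ≤ infDist y E ∧ infDist y E < s} ∩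
        ball x (T + 2 * s)), distWeight E α y ∂μ with hL
  set Ψ := ∫⁻ y in ({y | infDist y E < s} ∩ ball x (T + 2 * s)), distWeight E α y ∂μ with hΨ
  have hcs : c / 2 * s ≤ s := by nlinarith
  have h2 : Φ ≤ ENNReal.ofReal K * L := by
    refine le_trans (lintegral_mono_set ?_) h1
    exact inter_subset_inter_left _ fun v (hv : _ < _) => hv.trans_le hcs
  have h3 : Φ + L ≤ Ψ := by
    rw [hΦ, hL, ← lintegral_union]
    · refine lintegral_mono_set (union_subset ?_ ?_)
      · rintro v ⟨hv1, hv2⟩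
        refine ⟨lt_of_lt_of_le hv1 hcs, ball_subset_ball (by linarith) hv2⟩
      · rintro v ⟨hv1, hv2⟩
        exact ⟨hv1.2, hv2⟩
    · refine MeasurableSet.inter ?_ measurableSet_ball
      exact (measurableSet_le measurable_const (continuous_infDist_pt E).measurable).inter
        (measurableSet_lt (continuous_infDist_pt E).measurable measurable_const)
    · rw [Set.disjoint_left]
      rintro v ⟨hv1, _⟩ ⟨hv2, _⟩
      exact absurd hv1 (not_lt.2 hv2.1)
  have h4 : ENNReal.ofReal (1 + K) * Φ ≤ ENNReal.ofReal K * Ψ := by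
    calc ENNReal.ofReal (1 + K) * Φ = Φ + ENNReal.ofReal K * Φ := by
          rw [ENNReal.ofReal_add (by norm_num) hK.le]; simp [add_mul]
      _ ≤ ENNReal.ofReal K * L + ENNReal.ofReal K * Φ := by gcongr
      _ = ENNReal.ofReal K * (Φ + L) := by ring
      _ ≤ _ := by gcongr
  have h5 : ENNReal.ofReal (1 + K) ≠ 0 := by simp; linarith
  rw [ENNReal.ofReal_div_of_pos (by positivity), ← ENNReal.mul_div_right_comm,
    ENNReal.le_div_iff_mul_le (Or.inl h5) (Or.inl ENNReal.ofReal_ne_top), mul_comm]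
  exact h4

lemma iter (μ : Measure X) (E : Set X) {c q : ℝ} (hc : 0 < c) (hc1 : c < 1) {D : ℝ≥0∞} {α : ℝ}
    (h : ∀ x : X, ∀ T s : ℝ, 0 < T → 0 < s → ENNReal.ofReal s < D →
      ∫⁻ y in ({y | infDist y E < c / 2 * s} ∩ ball x T), distWeight E α y ∂μ ≤
      ENNReal.ofReal q * ∫⁻ y in ({y | infDist y E < s} ∩
        ball x (T + 2 * s)), distWeight E α y ∂μ) (x : X) (n : ℕ) :
    ∀ T s : ℝ, 0 < T → 0 < s → ENNReal.ofReal s < D →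
      ∫⁻ y in ({y | infDist y E < (c / 2) ^ n * s} ∩ ball x T), distWeight E α y ∂μ ≤
      ENNReal.ofReal q ^ n * ∫⁻ y in ({y | infDist y E < s} ∩
        ball x (T + 4 * s)), distWeight E α y ∂μ := by
  induction n with
  | zero =>
    intro T s hT hs hsD
    simp only [pow_zero, one_mul]
    exact lintegral_mono_set (inter_subset_inter_right _ (ball_subset_ball (by linarith)))
  | succ n ih =>
    intro T s hT hs hsD
    have hcs : c / 2 * s ≤ s := by nlinarith
    have hcs0 : 0 < c / 2 * s := by positivity
    have h1 := ih T (c / 2 * s) hT hcs0 ((ENNReal.ofReal_le_ofReal hcs).trans_lt hsD)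
    have h2 := h x (T + 4 * (c / 2 * s)) s (by positivity) hs hsD
    rw [show (c / 2) ^ (n + 1) * s = (c / 2) ^ n * (c / 2 * s) by ring]
    refine h1.trans ?_
    calc _ ≤ ENNReal.ofReal q ^ n * (ENNReal.ofReal q * ∫⁻ y in ({y | infDist y E < s} ∩
        ball x (T + 4 * (c / 2 * s) + 2 * s)), distWeight E α y ∂μ) := by gcongr
      _ ≤ ENNReal.ofReal q ^ n * (ENNReal.ofReal q * ∫⁻ y in ({y | infDist y E < s} ∩
        ball x (T + 4 * s)), distWeight E α y ∂μ) := by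
          have : T + 4 * (c / 2 * s) + 2 * s ≤ T + 4 * s := by nlinarith
          have := ball_subset_ball (x := x) this
          gcongr
      _ = _ := by rw [pow_succ]; ring

lemma self_improve (μ : Measure X) (hballs : BallsPosFinite μ) (hdbl : Doubling μ)
    (E : Set X) (hE : E.Nonempty) (hpor : IsPorous E)
    {α C : ℝ} (hα : 0 ≤ α) (hC : 0 < C)
    (hA : AikP μ E α C (2 * EMetric.diam (univ : Set X))) :
    ∃ ε : ℝ, 0 < ε ∧ α + ε ∈ assouadCodimBddSet μ E := by
  obtain ⟨CD, _, hd⟩ := hdbl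
  obtain ⟨c, hc, hc1, hpor⟩ := hpor
  obtain ⟨q, hq, hq1, h⟩ := step2 μ hballs hd E hE hc hc1 hpor hα hC.le hA
  have hl : 0 < c / 2 := by positivity
  have hl1 : c / 2 < 1 := by linarith
  have hlogl : Real.log (c / 2) < 0 := Real.log_neg hl hl1
  set ε := Real.log q / Real.log (c / 2) with hε
  have hε0 : 0 < ε := div_pos_of_neg_of_neg (Real.log_neg hq hq1) hlogl
  have hlq : (c / 2) ^ ε = q := by
    rw [Real.rpow_def_of_pos hl, hε, mul_div_cancel₀ _ hlogl.ne, Real.exp_log hq]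
  refine ⟨ε, hε0, by positivity, max 1 (C / q), le_max_left _ _, ?_⟩
  intro x hx r R hr hrR hRD
  have hR : 0 < R := hr.trans hrR
  obtain ⟨n, hn1, hn2⟩ := exists_nat_pow_near_of_lt_one (div_pos hr hR)
    ((div_le_one hR).2 hrR.le) hl hl1
  have hrn : r ≤ (c / 2) ^ n * R := (div_le_iff₀ hR).1 hn2
  have h1 : ENNReal.ofReal (r ^ (-α)) * μ ({y : X | infDist y E < r} ∩ ball x R) ≤
      ∫⁻ y in ({y | infDist y E < r} ∩ ball x R), distWeight E α y ∂μ := by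
    rw [← setLIntegral_const]
    exact setLIntegral_mono (measurable_distWeight E α)
        fun v hv => distWeight_ge hα hr (le_of_lt hv.1)
  have h2 : ∫⁻ y in ({y | infDist y E < r} ∩ ball x R), distWeight E α y ∂μ ≤
      ENNReal.ofReal q ^ n * (ENNReal.ofReal (C * R ^ (-α)) * μ (ball x R)) := by
    calc _ ≤ ∫⁻ y in ({y | infDist y E < (c / 2) ^ n * R} ∩ ball x R), distWeight E α y ∂μ :=
          lintegral_mono_set (inter_subset_inter_left _ fun v (hv : _ < _) => hv.trans_le hrn)
      _ ≤ _ := iter μ E hc hc1 h x n R R hR hR hRD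
      _ ≤ ENNReal.ofReal q ^ n * ∫⁻ y in ball x (8 * R), distWeight E α y ∂μ := by
        gcongr
        exact inter_subset_right.trans (ball_subset_ball (by linarith))
      _ ≤ _ := by
        gcongr
        exact hA x hx R hR hRD
  have h3 : μ ({y : X | infDist y E < r} ∩ ball x R) = ENNReal.ofReal (r ^ α) *
      (ENNReal.ofReal (r ^ (-α)) * μ ({y : X | infDist y E < r} ∩ ball x R)) := by
    rw [← mul_assoc, ← ENNReal.ofReal_mul (by positivity), ← Real.rpow_add hr]
    simp
  rw [h3]
  calc _ ≤ ENNReal.ofReal (r ^ α) *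
        (ENNReal.ofReal q ^ n * (ENNReal.ofReal (C * R ^ (-α)) * μ (ball x R))) := by
        exact mul_le_mul_right (h1.trans h2) _
    _ = ENNReal.ofReal (r ^ α * (q ^ n * (C * R ^ (-α)))) * μ (ball x R) := by
      rw [ENNReal.ofReal_mul (p := r ^ α) (by positivity),
        ENNReal.ofReal_mul (p := q ^ n) (by positivity), ENNReal.ofReal_pow hq.le]
      ring
    _ ≤ _ := by
      refine mul_le_mul_left (ENNReal.ofReal_le_ofReal ?_) _
      have h5 : q ^ (n + 1) ≤ (r / R) ^ ε := by
        rw [← hlq, ← Real.rpow_natCast, ← Real.rpow_mul hl.le, mul_comm, Real.rpow_mul hl.le,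
          Real.rpow_natCast]
        exact Real.rpow_le_rpow (by positivity) hn1.le hε0.le
      calc r ^ α * (q ^ n * (C * R ^ (-α))) = (C / q) * ((r / R) ^ α * q ^ (n + 1)) := by
            rw [Real.div_rpow hr.le hR.le, Real.rpow_neg hR.le, pow_succ]
            field_simp
        _ ≤ max 1 (C / q) * ((r / R) ^ α * (r / R) ^ ε) := by
          gcongr
          exact le_max_right _ _
        _ = _ := by rw [← Real.rpow_add (by positivity)]

lemma shrink_ball [Nontrivial X] (z : X) (R : ℝ) (hR : 0 < R) :
    ∃ R' : ℝ, 0 < R' ∧ R' ≤ R ∧ ENNReal.ofReal R' < 2 * EMetric.diam (univ : Set X) ∧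
      ball z R ⊆ ball z R' := by
  by_cases h : ENNReal.ofReal R < 2 * EMetric.diam (univ : Set X)
  · exact ⟨R, hR, le_rfl, h, subset_rfl⟩
  rw [not_lt] at h
  have hfin : EMetric.diam (univ : Set X) ≠ ∞ := by
    intro htop
    rw [htop] at h
    simp at h
  have hbd : Bornology.IsBounded (univ : Set X) := Metric.isBounded_iff_ediam_ne_top.2 hfin
  have hpos : 0 < EMetric.diam (univ : Set X) := Metric.ediam_pos_iff.2 nontrivial_univ
  set d := (EMetric.diam (univ : Set X)).toReal with hd
  have hdpos : 0 < d := ENNReal.toReal_pos hpos.ne' hfin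
  have hde : EMetric.diam (univ : Set X) = ENNReal.ofReal d := (ENNReal.ofReal_toReal hfin).symm
  have h2 : (2 : ℝ≥0∞) * ENNReal.ofReal d = ENNReal.ofReal (2 * d) := by
    rw [ENNReal.ofReal_mul (by norm_num)]; simp
  rw [hde, h2] at h ⊢
  rw [ENNReal.ofReal_le_ofReal_iff hR.le] at h
  refine ⟨3 / 2 * d, by positivity, by linarith,
    (ENNReal.ofReal_lt_ofReal_iff (by positivity)).2 (by linarith), ?_⟩
  intro y _
  have : dist y z ≤ d := Metric.dist_le_diam_of_mem hbd (mem_univ _) (mem_univ _)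
  rw [mem_ball]; linarith

lemma codim_ext (μ : Measure X) (E : Set X) {ρ C : ℝ} (hρ : 0 ≤ ρ) (hC : 1 ≤ C)
    (h : ∀ x ∈ E, ∀ r R : ℝ, 0 < r → r < R →
    ENNReal.ofReal R < 2 * EMetric.diam (univ : Set X) →
    μ ({y : X | infDist y E < r} ∩ ball x R) ≤
      ENNReal.ofReal (C * (r / R) ^ ρ) * μ (ball x R)) :
    ∀ x ∈ E, ∀ r R : ℝ, 0 < r → 0 < R →
    ENNReal.ofReal R < 2 * EMetric.diam (univ : Set X) →
    μ ({y : X | infDist y E < r} ∩ ball x R) ≤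
      ENNReal.ofReal (C * (r / R) ^ ρ) * μ (ball x R) := by
  intro x hx r R hr hR hRD
  rcases lt_or_ge r R with hlt | hge
  · exact h x hx r R hr hlt hRD
  · have h1 : 1 ≤ C * (r / R) ^ ρ := by
      have := Real.one_le_rpow ((one_le_div hR).2 hge) hρ
      nlinarith
    calc _ ≤ 1 * μ (ball x R) := by rw [one_mul]; exact measure_mono inter_subset_right
      _ ≤ _ := by
        gcongr
        rwa [← ENNReal.ofReal_one, ENNReal.ofReal_le_ofReal_iff (by linarith)]

lemma null_of_codim [Nontrivial X] (μ : Measure X) (hballs : BallsPosFinite μ) (E : Set X)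
    (hE : E.Nonempty) {ρ C : ℝ} (hρ : 0 < ρ)
    (h : ∀ x ∈ E, ∀ r R : ℝ, 0 < r → 0 < R →
    ENNReal.ofReal R < 2 * EMetric.diam (univ : Set X) →
    μ ({y : X | infDist y E < r} ∩ ball x R) ≤
      ENNReal.ofReal (C * (r / R) ^ ρ) * μ (ball x R)) : μ E = 0 := by
  obtain ⟨z, hz⟩ := hE
  have h1 : ∀ R : ℝ, 0 < R → μ (E ∩ ball z R) = 0 := by
    intro R hR
    obtain ⟨R', hR', _, hRD, hsub⟩ := shrink_ball z R hR
    have hb : ∀ r : ℝ, 0 < r → μ (E ∩ ball z R) ≤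
        ENNReal.ofReal (C * (r / R') ^ ρ) * μ (ball z R') := by
      intro r hr
      refine le_trans (measure_mono ?_) (h z hz r R' hr hR' hRD)
      refine inter_subset_inter (fun v hv => ?_) hsub
      show infDist v E < r
      rw [infDist_zero_of_mem hv]; exact hr
    have ht : Filter.Tendsto (fun r : ℝ => ENNReal.ofReal (C * (r / R') ^ ρ) * μ (ball z R'))
        (nhdsWithin 0 (Ioi 0)) (nhds 0) := by
      have h0 : Filter.Tendsto (fun r : ℝ => C * (r / R') ^ ρ) (nhds 0) (nhds 0) := by
        have : Continuous (fun r : ℝ => C * (r / R') ^ ρ) :=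
          continuous_const.mul ((continuous_id.div_const _).rpow_const fun _ => Or.inr hρ.le)
        have h2 := this.tendsto 0
        simpa [Real.zero_rpow hρ.ne'] using h2
      have h3 := (ENNReal.tendsto_ofReal h0).mono_left (nhdsWithin_le_nhds (s := Ioi 0))
      have h4 := ENNReal.Tendsto.mul_const (b := μ (ball z R')) h3
        (Or.inr (hballs z R' hR').2.ne)
      simpa using h4
    refine le_antisymm (ge_of_tendsto ht ?_) zero_le
    filter_upwards [self_mem_nhdsWithin] with r hr using hb r hr
  have h2 : E ⊆ ⋃ n : ℕ, E ∩ ball z ((n : ℝ) + 1) := by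
    intro v hv
    obtain ⟨n, hn⟩ := exists_nat_gt (dist v z)
    exact mem_iUnion.2 ⟨n, hv, by rw [mem_ball]; linarith⟩
  exact measure_mono_null h2 (measure_iUnion_null fun n => h1 _ (by positivity))

lemma aikawa_of_codim [Nontrivial X] (μ : Measure X) (hballs : BallsPosFinite μ) (E : Set X)
    (hE : E.Nonempty) (hEc : IsClosed E) {α ρ C : ℝ} (hα : 0 ≤ α) (hαρ : α < ρ) (hC : 1 ≤ C)
    (h : ∀ x ∈ E, ∀ r R : ℝ, 0 < r → 0 < R →
    ENNReal.ofReal R < 2 * EMetric.diam (univ : Set X) →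
    μ ({y : X | infDist y E < r} ∩ ball x R) ≤
      ENNReal.ofReal (C * (r / R) ^ ρ) * μ (ball x R)) :
    ∃ C' : ℝ, 0 < C' ∧ ∀ x ∈ E, ∀ R : ℝ, 0 < R →
      ENNReal.ofReal R < 2 * EMetric.diam (univ : Set X) →
      ∫⁻ y in ball x R, distWeight E α y ∂μ ≤
        ENNReal.ofReal (C' * R ^ (-α)) * μ (ball x R) := by
  have hnull := null_of_codim μ hballs E hE (hα.trans_lt hαρ) h
  set t : ℝ := (1 / 2 : ℝ) ^ (ρ - α) with ht
  have ht0 : 0 < t := by positivity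
  have ht1 : t < 1 := Real.rpow_lt_one (by norm_num) (by norm_num) (by linarith)
  have hgeo := hasSum_geometric_of_lt_one ht0.le ht1
  have h1t : 0 < 1 - t := by linarith
  refine ⟨C * 2 ^ ρ * 2 ^ α * (1 - t)⁻¹, by positivity, ?_⟩
  intro x hx R hR hRD
  set S : ℕ → Set X := fun j =>
    {y | (1 / 2 : ℝ) ^ (j + 1) * R ≤ infDist y E ∧ infDist y E ≤ (1 / 2 : ℝ) ^ j * R} ∩ ball x R
    with hS
  have hcov : ball x R ⊆ E ∪ ⋃ j, S j := by
    intro y hy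
    by_cases hyE : y ∈ E
    · exact Or.inl hyE
    right
    have hpos : 0 < infDist y E := (hEc.notMem_iff_infDist_pos hE).1 hyE
    have hlt : infDist y E < R := (infDist_le_dist_of_mem hx).trans_lt hy
    obtain ⟨n, hn1, hn2⟩ := exists_nat_pow_near_of_lt_one (div_pos hpos hR)
      ((div_le_one hR).2 hlt.le) (show (0:ℝ) < 1 / 2 by norm_num) (by norm_num)
    exact mem_iUnion.2 ⟨n, ⟨((lt_div_iff₀ hR).1 hn1).le, (div_le_iff₀ hR).1 hn2⟩, hy⟩
  have hSj : ∀ j, ∫⁻ y in S j, distWeight E α y ∂μ ≤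
      ENNReal.ofReal (C * 2 ^ ρ * 2 ^ α * R ^ (-α)) * μ (ball x R) * ENNReal.ofReal (t ^ j) := by
    intro j
    have hj : (0:ℝ) < (1 / 2 : ℝ) ^ j := by positivity
    have hr : 0 < 2 * ((1 / 2 : ℝ) ^ j * R) := by positivity
    calc _ ≤ ∫⁻ _ in S j, ENNReal.ofReal (((1 / 2 : ℝ) ^ (j + 1) * R) ^ (-α)) ∂μ :=
          setLIntegral_mono measurable_const fun y hy => distWeight_le hα (by positivity) hy.1.1
      _ = ENNReal.ofReal (((1 / 2 : ℝ) ^ (j + 1) * R) ^ (-α)) * μ (S j) := setLIntegral_const _ _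
      _ ≤ ENNReal.ofReal (((1 / 2 : ℝ) ^ (j + 1) * R) ^ (-α)) *
          (ENNReal.ofReal (C * (2 * ((1 / 2 : ℝ) ^ j * R) / R) ^ ρ) * μ (ball x R)) := by
        gcongr
        refine le_trans (measure_mono ?_) (h x hx (2 * ((1 / 2 : ℝ) ^ j * R)) R hr hR hRD)
        refine inter_subset_inter_left _ fun v hv => ?_
        show infDist v E < _
        have := hv.2
        linarith
      _ = _ := by
        rw [← mul_assoc, mul_right_comm _ (μ (ball x R)), ← ENNReal.ofReal_mul (by positivity),
          ← ENNReal.ofReal_mul (by positivity)]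
        congr 2
        rw [show 2 * ((1 / 2 : ℝ) ^ j * R) / R = 2 * (1 / 2 : ℝ) ^ j by field_simp,
          Real.mul_rpow (by positivity) hR.le, Real.mul_rpow (by positivity) hj.le, pow_succ,
          Real.mul_rpow hj.le (by positivity)]
        have e1 : (1 / 2 : ℝ) ^ (-α) = 2 ^ α := by
          rw [one_div, Real.inv_rpow (by norm_num), Real.rpow_neg (by norm_num), inv_inv]
        have e2 : t ^ j = ((1 / 2 : ℝ) ^ j) ^ (-α) * ((1 / 2 : ℝ) ^ j) ^ ρ := by
          rw [← Real.rpow_add hj, ht, ← Real.rpow_natCast, ← Real.rpow_natCast,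
            ← Real.rpow_mul (by norm_num), ← Real.rpow_mul (by norm_num)]
          congr 1; ring
        rw [e1, e2]; ring
  calc _ ≤ ∫⁻ y in E ∪ ⋃ j, S j, distWeight E α y ∂μ := lintegral_mono_set hcov
    _ ≤ ∫⁻ y in E, distWeight E α y ∂μ + ∫⁻ y in ⋃ j, S j, distWeight E α y ∂μ :=
      lintegral_union_le _ _ _
    _ = ∫⁻ y in ⋃ j, S j, distWeight E α y ∂μ := by
      rw [setLIntegral_measure_zero _ _ hnull, zero_add]
    _ ≤ ∑' j, ∫⁻ y in S j, distWeight E α y ∂μ := lintegral_iUnion_le _ _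
    _ ≤ ∑' j, ENNReal.ofReal (C * 2 ^ ρ * 2 ^ α * R ^ (-α)) * μ (ball x R) *
        ENNReal.ofReal (t ^ j) := ENNReal.tsum_le_tsum hSj
    _ = _ := by
      rw [ENNReal.tsum_mul_left, ← ENNReal.ofReal_tsum_of_nonneg (fun _ => by positivity)
        hgeo.summable, hgeo.tsum_eq, mul_right_comm, ← ENNReal.ofReal_mul (by positivity)]
      congr 2; ring

lemma codim_bddAbove [Nontrivial X] (μ : Measure X) (hballs : BallsPosFinite μ)
    (hdbl : Doubling μ) (E : Set X) (hE : E.Nonempty) :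
    BddAbove (assouadCodimBddSet μ E) := by
  obtain ⟨CD, hCD, hd⟩ := hdbl
  obtain ⟨N, hN⟩ : ∃ N : ℕ, CD < 2 ^ N := pow_unbounded_of_one_lt _ (by norm_num)
  refine ⟨N, ?_⟩
  rintro ρ ⟨hρ0, C, hC, h⟩
  by_contra hlt
  rw [not_le] at hlt
  obtain ⟨x, hx⟩ := hE
  obtain ⟨R, hR, _, hRD, _⟩ := shrink_ball x 1 one_pos
  set a : ℝ := (1 / 2 : ℝ) ^ ρ * CD with ha
  have ha0 : 0 ≤ a := by positivity
  have ha1 : a < 1 := by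
    have h1 : CD < 2 ^ ρ := by
      refine hN.trans ?_
      rw [← Real.rpow_natCast]
      exact Real.rpow_lt_rpow_of_exponent_lt (by norm_num) hlt
    rw [ha, one_div, Real.inv_rpow (by norm_num), inv_mul_lt_iff₀ (by positivity)]
    linarith
  have key : ∀ k : ℕ, 1 ≤ C * a ^ (k + 1) := by
    intro k
    have hp1 : (1 / 2 : ℝ) ^ (k + 1) < 1 := pow_lt_one₀ (by norm_num) (by norm_num) (by simp)
    have hp0 : (0 : ℝ) < (1 / 2 : ℝ) ^ (k + 1) := by positivity
    have hr : 0 < (1 / 2 : ℝ) ^ (k + 1) * R := by positivity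
    have h1 := h x hx ((1 / 2 : ℝ) ^ (k + 1) * R) R hr (by nlinarith) hRD
    have h2 := doubling_pow hd (k + 1) x ((1 / 2 : ℝ) ^ (k + 1) * R) hr
    rw [← mul_assoc, ← mul_pow] at h2
    norm_num at h2
    have h3 : μ (ball x ((1 / 2 : ℝ) ^ (k + 1) * R)) ≤
        μ ({y : X | infDist y E < (1 / 2 : ℝ) ^ (k + 1) * R} ∩ ball x R) := by
      refine measure_mono fun v hv => ⟨(infDist_le_dist_of_mem hx).trans_lt hv,
        ball_subset_ball (by nlinarith) hv⟩
    rw [mul_div_cancel_right₀ _ hR.ne'] at h1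
    have hm := hballs x _ hr
    set m := μ (ball x ((1 / 2 : ℝ) ^ (k + 1) * R)) with hmdef
    have h4 : 1 * m ≤ ENNReal.ofReal (C * a ^ (k + 1)) * m := by
      rw [one_mul]
      calc m ≤ _ := h3
        _ ≤ _ := h1
        _ ≤ ENNReal.ofReal (C * ((1 / 2 : ℝ) ^ (k + 1)) ^ ρ) * (ENNReal.ofReal CD ^ (k + 1) * m) :=
          by gcongr
        _ = _ := by
          rw [← mul_assoc, ← ENNReal.ofReal_pow hCD.le, ← ENNReal.ofReal_mul (by positivity)]
          congr 2
          rw [ha, mul_pow, ← Real.rpow_natCast, ← Real.rpow_natCast, ← Real.rpow_natCast,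
            ← Real.rpow_mul (by norm_num), ← Real.rpow_mul (by norm_num), mul_comm ρ, mul_assoc]
    have h5 := (ENNReal.mul_le_mul_iff_left hm.1.ne' hm.2.ne).1 h4
    rwa [← ENNReal.ofReal_one, ENNReal.ofReal_le_ofReal_iff (by positivity)] at h5
  have ht : Filter.Tendsto (fun k : ℕ => C * a ^ (k + 1)) Filter.atTop (nhds 0) := by
    have := ((tendsto_pow_atTop_nhds_zero_of_lt_one ha0 ha1).comp
      (Filter.tendsto_add_atTop_nat 1)).const_mul C
    simpa using this
  have := ge_of_tendsto ht (Filter.Eventually.of_forall key)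
  linarith

lemma nonneg_of_memA1 (μ : Measure X) (hballs : BallsPosFinite μ) (E : Set X)
    (hE : E.Nonempty) {α : ℝ} (h : MemA1 μ (distWeight E α)) : 0 ≤ α := by
  by_contra hα
  rw [not_le] at hα
  obtain ⟨⟨hm, hpos, _⟩, A, hA, h⟩ := h
  obtain ⟨z, hz⟩ := hE
  have h1 := h z 1 one_pos
  have htop : essSup (fun y => (distWeight E α y)⁻¹) (μ.restrict (ball z 1)) = ∞ := by
    refine ENNReal.eq_top_of_forall_nnreal_le fun n => ?_
    set e : ℝ := ((n : ℝ) + 1) ^ (1 / α) with he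
    have he0 : 0 < e := by positivity
    have he1 : e ≤ 1 := Real.rpow_le_one_of_one_le_of_nonpos (by simp)
      (by rw [one_div, inv_nonpos]; exact hα.le)
    have hee : e ^ α = (n : ℝ) + 1 := by
      rw [he, ← Real.rpow_mul (by positivity), one_div, inv_mul_cancel₀ hα.ne, Real.rpow_one]
    refine le_essSup_of_subset (S := ball z e) (ball_subset_ball he1) (hballs z e he0).1.ne' ?_
    intro y hy
    rw [distWeight_inv]
    have hle : infDist y E ≤ e := ((infDist_le_dist_of_mem hz).trans_lt hy).le
    calc (n : ℝ≥0∞) ≤ ENNReal.ofReal ((n : ℝ) + 1) := by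
          rw [← ENNReal.ofReal_coe_nnreal]
          exact ENNReal.ofReal_le_ofReal (by linarith)
      _ = ENNReal.ofReal e ^ α := by rw [← hee, ENNReal.ofReal_rpow_of_pos he0]
      _ ≤ _ := by
        have hn : 0 ≤ -α := by linarith
        have h5 := ENNReal.rpow_le_rpow (ENNReal.ofReal_le_ofReal hle) hn
        have h6 := ENNReal.inv_le_inv.2 h5
        simpa only [← ENNReal.rpow_neg, neg_neg] using h6
  have hI : ∫⁻ y in ball z 1, distWeight E α y ∂μ ≠ 0 := by
    intro h0
    rw [lintegral_eq_zero_iff hm] at h0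
    have h2 : ∀ᵐ y ∂(μ.restrict (ball z 1)), False := by
      filter_upwards [h0, ae_restrict_of_ae hpos] with y hy1 hy2
      exact hy2.1.ne' hy1
    have h3 : μ.restrict (ball z 1) = 0 := by simpa using h2
    rw [Measure.restrict_eq_zero] at h3
    exact (hballs z 1 one_pos).1.ne' h3
  rw [htop, ENNReal.mul_top (ENNReal.div_ne_zero.2 ⟨hI, (hballs z 1 one_pos).2.ne⟩)] at h1
  exact absurd h1 (by simp)

lemma aikP_of_memA1 (μ : Measure X) (hballs : BallsPosFinite μ) (hdbl : Doubling μ) (E : Set X)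
    (hE : E.Nonempty) (hpor : IsPorous E) {α : ℝ} (hα : 0 ≤ α)
    (h : MemA1 μ (distWeight E α)) :
    ∃ C : ℝ, 0 < C ∧ AikP μ E α C (2 * EMetric.diam (univ : Set X)) := by
  obtain ⟨CD, hCD, hd⟩ := hdbl
  obtain ⟨c, hc, hc1, hpor⟩ := hpor
  obtain ⟨_, A, hA, h⟩ := h
  refine ⟨A * CD ^ 3 * (c / 2) ^ (-α), by positivity, ?_⟩
  intro x hx r hr hrD
  obtain ⟨y, hy⟩ := hpor x hx r hr hrD
  have hcr : 0 < c / 2 * r := by positivity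
  have hp := fun u hu => porous_half hE hx hc hr hy (u := u) hu
  have hess : ENNReal.ofReal ((c / 2 * r) ^ α) ≤
      essSup (fun y => (distWeight E α y)⁻¹) (μ.restrict (ball x (8 * r))) := by
    refine le_essSup_of_subset (S := ball y (c / 2 * r)) ?_ (hballs y _ hcr).1.ne' ?_
    · exact fun u hu => ball_subset_ball (by linarith) (hp u hu).2.2
    · intro u hu
      rw [distWeight_inv, ← ENNReal.ofReal_rpow_of_pos hcr]
      exact ENNReal.rpow_le_rpow (ENNReal.ofReal_le_ofReal (hp u hu).1) hα
  have h1 := h x (8 * r) (by positivity)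
  have hB := hballs x (8 * r) (by positivity)
  set I := ∫⁻ y in ball x (8 * r), distWeight E α y ∂μ with hI
  have h2 : I / μ (ball x (8 * r)) * ENNReal.ofReal ((c / 2 * r) ^ α) ≤ ENNReal.ofReal A :=
    (mul_le_mul_right hess _).trans h1
  have h3 : I = (I / μ (ball x (8 * r)) * ENNReal.ofReal ((c / 2 * r) ^ α)) *
      (ENNReal.ofReal ((c / 2 * r) ^ (-α)) * μ (ball x (8 * r))) := by
    have e1 : ENNReal.ofReal ((c / 2 * r) ^ α) * ENNReal.ofReal ((c / 2 * r) ^ (-α)) = 1 := by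
      rw [← ENNReal.ofReal_mul (by positivity), ← Real.rpow_add hcr]; simp
    calc I = I / μ (ball x (8 * r)) * μ (ball x (8 * r)) :=
          (ENNReal.div_mul_cancel hB.1.ne' hB.2.ne).symm
      _ = I / μ (ball x (8 * r)) * (ENNReal.ofReal ((c / 2 * r) ^ α) *
          ENNReal.ofReal ((c / 2 * r) ^ (-α))) * μ (ball x (8 * r)) := by rw [e1, mul_one]
      _ = _ := by ring
  have h4 : μ (ball x (8 * r)) ≤ ENNReal.ofReal CD ^ 3 * μ (ball x r) := by
    have := doubling_pow hd 3 x r hr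
    norm_num at this ⊢
    exact this
  calc I = _ := h3
    _ ≤ ENNReal.ofReal A * (ENNReal.ofReal ((c / 2 * r) ^ (-α)) *
        (ENNReal.ofReal CD ^ 3 * μ (ball x r))) := by gcongr
    _ = _ := by
      rw [← ENNReal.ofReal_pow hCD.le, ← mul_assoc, ← mul_assoc,
        ← ENNReal.ofReal_mul (by positivity), ← ENNReal.ofReal_mul (by positivity),
        Real.mul_rpow (by positivity) hr.le]
      congr 2; ring

lemma aikP_zero (μ : Measure X) (hdbl : Doubling μ) (E : Set X) (D : ℝ≥0∞) :
    ∃ C : ℝ, 0 < C ∧ AikP μ E 0 C D := by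
  obtain ⟨CD, hCD, hd⟩ := hdbl
  refine ⟨CD ^ 3, by positivity, ?_⟩
  intro x hx r hr hrD
  have := doubling_pow hd 3 x r hr
  norm_num at this
  simpa [distWeight, ENNReal.ofReal_pow hCD.le] using this

lemma memA1_of_codim [Nontrivial X] (μ : Measure X) (hballs : BallsPosFinite μ)
    (hdbl : Doubling μ) (E : Set X) (hE : E.Nonempty) (hEc : IsClosed E) {α ρ : ℝ} (hα : 0 ≤ α)
    (hαρ : α < ρ) (hρ : ρ ∈ assouadCodimBddSet μ E) : MemA1 μ (distWeight E α) := by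
  obtain ⟨CD, hCD, hd⟩ := hdbl
  obtain ⟨hρ0, C, hC, h⟩ := hρ
  have hext := codim_ext μ E hρ0 hC h
  have hnull := null_of_codim μ hballs E hE (hα.trans_lt hαρ) hext
  obtain ⟨C', hC', hAik⟩ := aikawa_of_codim μ hballs E hE hEc hα hαρ hC hext
  set K : ℝ := C' * CD ^ 3 + 3 ^ α with hK
  have hK0 : 0 < K := by positivity
  have key : ∀ (x : X) (r : ℝ), 0 < r → ∃ M : ℝ, 0 < M ∧
      ∫⁻ y in ball x r, distWeight E α y ∂μ ≤ ENNReal.ofReal (K * M ^ (-α)) * μ (ball x r) ∧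
      ∀ y ∈ ball x r, infDist y E ≤ M := by
    intro x r hr
    rcases le_or_gt (2 * r) (infDist x E) with hfar | hnear
    · set d := infDist x E with hdx
      have hd0 : 0 < d := by linarith
      refine ⟨3 / 2 * d, by positivity, ?_, ?_⟩
      · calc _ ≤ ∫⁻ _ in ball x r, ENNReal.ofReal ((d / 2) ^ (-α)) ∂μ := by
              refine setLIntegral_mono measurable_const fun y hy => distWeight_le hα (by positivity) ?_
              have h1 := infDist_le_infDist_add_dist (s := E) (x := x) (y := y)
              rw [mem_ball, dist_comm] at hy
              linarith
          _ = ENNReal.ofReal ((d / 2) ^ (-α)) * μ (ball x r) := setLIntegral_const _ _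
          _ ≤ _ := by
            refine mul_le_mul_left (ENNReal.ofReal_le_ofReal ?_) _
            have e1 : (d / 2) ^ (-α) = 3 ^ α * (3 / 2 * d) ^ (-α) := by
              rw [show 3 / 2 * d = 3 * (d / 2) by ring, Real.mul_rpow (by norm_num) (by positivity),
                ← mul_assoc, ← Real.rpow_add (by norm_num)]
              simp
            rw [e1, hK]
            gcongr
            have : 0 < C' * CD ^ 3 := by positivity
            linarith
      · intro y hy
        have h1 := infDist_le_infDist_add_dist (s := E) (x := y) (y := x)
        rw [mem_ball] at hy
        linarith
    · obtain ⟨z, hz, hxz⟩ := (infDist_lt_iff hE).1 hnear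
      obtain ⟨R, hR, hRr, hRD, hsub⟩ := shrink_ball z (3 * r) (by positivity)
      have hB : ball x r ⊆ ball z R := by
        refine Subset.trans (fun y hy => ?_) hsub
        rw [mem_ball] at hy ⊢
        have := dist_triangle y x z
        linarith
      refine ⟨R, hR, ?_, fun y hy => ((infDist_le_dist_of_mem hz).trans_lt (hB hy)).le⟩
      have hm : μ (ball z R) ≤ ENNReal.ofReal CD ^ 3 * μ (ball x r) := by
        refine le_trans (measure_mono fun y hy => ?_) (doubling_pow hd 3 x r hr)
        rw [mem_ball] at hy ⊢
        have := dist_triangle y z x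
        rw [dist_comm z x] at this
        linarith
      calc _ ≤ ∫⁻ y in ball z R, distWeight E α y ∂μ := lintegral_mono_set hB
        _ ≤ _ := hAik z hz R hR hRD
        _ ≤ ENNReal.ofReal (C' * R ^ (-α)) * (ENNReal.ofReal CD ^ 3 * μ (ball x r)) := by gcongr
        _ = ENNReal.ofReal (C' * CD ^ 3 * R ^ (-α)) * μ (ball x r) := by
          rw [← ENNReal.ofReal_pow hCD.le, ← mul_assoc, ← ENNReal.ofReal_mul (by positivity)]
          congr 2; ring
        _ ≤ _ := by
          refine mul_le_mul_left (ENNReal.ofReal_le_ofReal ?_) _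
          rw [hK]
          gcongr
          have : (0:ℝ) < 3 ^ α := by positivity
          linarith
  refine ⟨⟨measurable_distWeight E α, ?_, ?_⟩, K, hK0, ?_⟩
  · have : ∀ᵐ x ∂μ, x ∉ E := measure_eq_zero_iff_ae_notMem.1 hnull
    filter_upwards [this] with x hx
    have hpos : 0 < infDist x E := (hEc.notMem_iff_infDist_pos hE).1 hx
    unfold distWeight
    rw [ENNReal.ofReal_rpow_of_pos hpos]
    exact ⟨ENNReal.ofReal_pos.2 (by positivity), ENNReal.ofReal_ne_top⟩
  · intro x r hr
    obtain ⟨M, hM, h1, _⟩ := key x r hr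
    exact ne_top_of_le_ne_top (ENNReal.mul_ne_top ENNReal.ofReal_ne_top (hballs x r hr).2.ne) h1
  · intro x r hr
    obtain ⟨M, hM, h1, h2⟩ := key x r hr
    have h3 : (∫⁻ y in ball x r, distWeight E α y ∂μ) / μ (ball x r) ≤
        ENNReal.ofReal (K * M ^ (-α)) := ENNReal.div_le_of_le_mul h1
    have h4 : essSup (fun y => (distWeight E α y)⁻¹) (μ.restrict (ball x r)) ≤
        ENNReal.ofReal (M ^ α) := by
      refine essSup_le_of_ae_le _ ?_
      filter_upwards [ae_restrict_mem measurableSet_ball] with y hy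
      rw [distWeight_inv, ← ENNReal.ofReal_rpow_of_pos hM]
      exact ENNReal.rpow_le_rpow (ENNReal.ofReal_le_ofReal (h2 y hy)) hα
    calc _ ≤ ENNReal.ofReal (K * M ^ (-α)) * ENNReal.ofReal (M ^ α) := mul_le_mul' h3 h4
      _ = ENNReal.ofReal K := by
        rw [← ENNReal.ofReal_mul (by positivity), mul_assoc, ← Real.rpow_add hM]
        simp

theorem distWeight_memA1_iff_of_porous [Nontrivial X]
    (μ : Measure X) (hballs : BallsPosFinite μ) (hdbl : Doubling μ)
    (E : Set X) (hE : E.Nonempty) (hEc : IsClosed E) (hpor : IsPorous E)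
    (α : ℝ) :
    MemA1 μ (distWeight E α) ↔ 0 ≤ α ∧ α < assouadCodim μ E := by
  have hbdd := codim_bddAbove μ hballs hdbl E hE
  constructor
  · intro h
    have hα := nonneg_of_memA1 μ hballs E hE h
    refine ⟨hα, ?_⟩
    obtain ⟨C, hC, hA⟩ := aikP_of_memA1 μ hballs hdbl E hE hpor hα h
    obtain ⟨ε, hε, hmem⟩ := self_improve μ hballs hdbl E hE hpor hα hC hA
    have := le_csSup hbdd hmem
    unfold assouadCodim
    linarith
  · rintro ⟨hα, hlt⟩
    obtain ⟨C, hC, hA⟩ := aikP_zero μ hdbl E (2 * EMetric.diam (univ : Set X))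
    obtain ⟨ε, hε, hmem⟩ := self_improve μ hballs hdbl E hE hpor le_rfl hC hA
    obtain ⟨ρ, hρ, hαρ⟩ := exists_lt_of_lt_csSup ⟨_, hmem⟩ hlt
    exact memA1_of_codim μ hballs hdbl E hE hEc hα hαρ hρ

end
end ApDistance
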